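/- arXiv:1810.02082 — 2 statements merged into one kernel-verified Lean document; each statement's English description precedes it below -/
import Mathlib

section
/- The toric ideal I_{(G,τ)} of a signed graph (G,τ) is generated by the set of binomials B_w associated with even closed walks w in (G,τ). -/
variable {V : Type*}

/-- The product of τ(e,u)·τ(e,v) over all edge terms e = uv of a walk in a signed
graph (G,τ), where the sign τ assigns a unit ±1 to each incidence. -/
def walkSign (G : SimpleGraph V) (τ : Sym2 V → V → ℤˣ) :
    {u v : V} → G.Walk u v → ℤˣ
  | _, _, SimpleGraph.Walk.nil => 1
  | _, _, @SimpleGraph.Walk.cons _ _ a b _ _ p =>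
      τ s(a, b) a * τ s(a, b) b * walkSign G τ p

/-- μ of a closed walk: (-1)^(number of unbalanced vertex terms). -/
def mu (G : SimpleGraph V) (τ : Sym2 V → V → ℤˣ) {u v : V} (w : G.Walk u v) : ℤˣ :=
  (-1) ^ w.length * walkSign G τ w

/-- The i-th dart (oriented edge term) of a walk. -/
def dartAt {G : SimpleGraph V} {u v : V} (w : G.Walk u v) (i : Fin w.length) :
    G.Dart :=
  w.darts.get (Fin.cast w.length_darts.symm i)

/-- Cyclic successor on `Fin n`. -/
def csucc {n : ℕ} (i : Fin n) : Fin n := ⟨(i + 1) % n, Nat.mod_lt _ i.pos⟩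

/-- `FlipRel G τ w κ`: κ assigns a sign ±1 to each edge term of the closed walk w,
flipping exactly at the unbalanced vertex terms (cyclically).  Such a κ records (up
to a global sign) the parity of the balanced section containing each edge term in the
balanced section-decomposition of w, and a κ satisfying this relation exists iff w is
even. -/
def FlipRel (G : SimpleGraph V) (τ : Sym2 V → V → ℤˣ) {v : V} (w : G.Walk v v)
    (κ : Fin w.length → ℤˣ) : Prop :=
  ∀ i : Fin w.length,
    κ (csucc i) =
      -(τ (dartAt w i).edge (dartAt w i).toProd.2 *
          τ (dartAt w (csucc i)).edge (dartAt w i).toProd.2) * κ i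

open MvPolynomial in
/-- The positive monomial B_w⁺ of the binomial associated with an even closed walk w,
relative to the section-parity assignment κ: the product of all edge terms lying in
the sections with κ = 1. -/
noncomputable def Bpos (K : Type*) [Field K] {G : SimpleGraph V} {v : V}
    (w : G.Walk v v) (κ : Fin w.length → ℤˣ) : MvPolynomial G.edgeSet K :=
  ∏ i ∈ Finset.univ.filter (fun i => κ i = 1),
    X (⟨(dartAt w i).edge, (dartAt w i).edge_mem⟩ : G.edgeSet)

open MvPolynomial in
/-- The negative monomial B_w⁻: the product of all edge terms in sections with κ = -1. -/
noncomputable def Bneg (K : Type*) [Field K] {G : SimpleGraph V} {v : V}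
    (w : G.Walk v v) (κ : Fin w.length → ℤˣ) : MvPolynomial G.edgeSet K :=
  ∏ i ∈ Finset.univ.filter (fun i => κ i = -1),
    X (⟨(dartAt w i).edge, (dartAt w i).edge_mem⟩ : G.edgeSet)

open MvPolynomial in
/-- The toric ideal I_{(G,τ)} of a signed graph: the ideal of K[e : e ∈ E(G)]
generated by the binomials e^{b⁺} - e^{b⁻} over integer vectors b in the kernel of
the incidence matrix A(G,τ). -/
noncomputable def toricIdeal (K : Type*) [Field K] [DecidableEq V]
    (G : SimpleGraph V) [Fintype G.edgeSet] (τ : Sym2 V → V → ℤˣ) :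
    Ideal (MvPolynomial G.edgeSet K) :=
  Ideal.span { f | ∃ b : G.edgeSet → ℤ,
    (∀ v : V, ∑ e : G.edgeSet,
      (if v ∈ (e : Sym2 V) then (τ e v : ℤ) else 0) * b e = 0) ∧
    f = (∏ e : G.edgeSet, X e ^ (b e).toNat)
      - ∏ e : G.edgeSet, X e ^ (-(b e)).toNat }

section Helpers

variable [DecidableEq V]

/-- The edge of the i-th dart. -/
def edgeAt {G : SimpleGraph V} {u v : V} (w : G.Walk u v) (i : Fin w.length) : G.edgeSet :=
  ⟨(dartAt w i).edge, (dartAt w i).edge_mem⟩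

/-- Number of edge terms equal to e with sign ε. -/
def cnt {G : SimpleGraph V} {u v : V} (w : G.Walk u v) (κ : Fin w.length → ℤˣ) (ε : ℤˣ)
    (e : G.edgeSet) : ℕ :=
  ∑ i, if κ i = ε ∧ edgeAt w i = e then 1 else 0

/-- Incidence matrix entries. -/
def inc {G : SimpleGraph V} (τ : Sym2 V → V → ℤˣ) (v : V) (e : G.edgeSet) : ℤ :=
  if v ∈ (e : Sym2 V) then (τ e v : ℤ) else 0

/-- The section signs obtained by starting with half-edge sign s. -/
def kap (G : SimpleGraph V) (τ : Sym2 V → V → ℤˣ) :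
    {u v : V} → ℤˣ → (w : G.Walk u v) → Fin w.length → ℤˣ
  | _, _, _, SimpleGraph.Walk.nil => fun _ => 1
  | _, _, s, @SimpleGraph.Walk.cons _ _ a b _ _ p =>
      Fin.cons (α := fun _ => ℤˣ) (s * τ s(a, b) a)
        (kap G τ (-(s * τ s(a, b) a * τ s(a, b) b)) p)

open MvPolynomial in
lemma prod_eq_cnt (K : Type*) [Field K] {G : SimpleGraph V} [Fintype G.edgeSet] {v : V}
    (w : G.Walk v v) (κ : Fin w.length → ℤˣ) (ε : ℤˣ) :
    (∏ i ∈ Finset.univ.filter (fun i => κ i = ε), (X (edgeAt w i) : MvPolynomial G.edgeSet K))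
      = ∏ e : G.edgeSet, X e ^ cnt w κ ε e := by
  rw [← Finset.prod_fiberwise _ (fun i => edgeAt w i)]
  refine Finset.prod_congr rfl fun e _ => ?_
  rw [Finset.prod_congr rfl (g := fun _ => X e), Finset.prod_const]
  · congr 1
    rw [cnt, ← Finset.card_filter, Finset.filter_filter]
  · intro i hi
    rw [(Finset.mem_filter.1 hi).2]

lemma inc_mk {G : SimpleGraph V} (τ : Sym2 V → V → ℤˣ) (x u v : V) (h : G.Adj u v) :
    inc (G := G) τ x ⟨s(u, v), h⟩ =
      (if x = u then (τ s(u, v) u : ℤ) else 0) + (if x = v then (τ s(u, v) v : ℤ) else 0) := by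
  have := h.ne
  unfold inc
  simp only [Sym2.mem_iff]
  by_cases h1 : x = u
  · subst h1; simp [this]
  · by_cases h2 : x = v
    · subst h2; simp [h1]
    · simp [h1, h2]

lemma inc_edgeAt {G : SimpleGraph V} (τ : Sym2 V → V → ℤˣ) (x : V) {u v : V}
    (w : G.Walk u v) (i : Fin w.length) :
    inc τ x (edgeAt w i) =
      (if x = (dartAt w i).fst then (τ (dartAt w i).edge (dartAt w i).fst : ℤ) else 0) +
      (if x = (dartAt w i).snd then (τ (dartAt w i).edge (dartAt w i).snd : ℤ) else 0) :=
  inc_mk τ x _ _ (dartAt w i).adj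

lemma dart_succ {G : SimpleGraph V} {u v : V} (w : G.Walk u v) (i j : Fin w.length)
    (hij : (j : ℕ) = i + 1) : (dartAt w j).fst = (dartAt w i).snd := by
  simp only [dartAt, List.get_eq_getElem]
  rw [SimpleGraph.Walk.fst_darts_getElem, SimpleGraph.Walk.snd_darts_getElem]
  simp [hij]

lemma dart_zero {G : SimpleGraph V} {u v : V} (w : G.Walk u v) (i : Fin w.length)
    (hi : (i : ℕ) = 0) : (dartAt w i).fst = u := by
  simp only [dartAt, List.get_eq_getElem]
  rw [SimpleGraph.Walk.fst_darts_getElem]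
  simp [hi]

lemma dart_last {G : SimpleGraph V} {u v : V} (w : G.Walk u v) (i : Fin w.length)
    (hi : (i : ℕ) + 1 = w.length) : (dartAt w i).snd = v := by
  simp only [dartAt, List.get_eq_getElem]
  rw [SimpleGraph.Walk.snd_darts_getElem]
  simp [hi]

lemma csucc_cases {n : ℕ} (i : Fin n) :
    ((csucc i : ℕ) = i + 1) ∨ ((i : ℕ) + 1 = n ∧ (csucc i : ℕ) = 0) := by
  unfold csucc
  rcases Nat.lt_or_ge (i + 1) n with h | h
  · left; simp [Nat.mod_eq_of_lt h]
  · right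
    have : (i : ℕ) + 1 = n := by omega
    simp [this]

lemma dart_csucc {G : SimpleGraph V} {v : V} (w : G.Walk v v) (i : Fin w.length) :
    (dartAt w (csucc i)).fst = (dartAt w i).snd := by
  rcases csucc_cases i with h | ⟨h, h'⟩
  · exact dart_succ w _ _ h
  · rw [dart_zero w _ h', dart_last w _ h]

lemma csucc_bij {n : ℕ} : Function.Bijective (csucc (n := n)) := by
  rw [← Finite.injective_iff_bijective]
  intro i j h
  have h := congrArg Fin.val h
  rcases csucc_cases i with h1 | ⟨h1, h1'⟩ <;> rcases csucc_cases j with h2 | ⟨h2, h2'⟩ <;>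
    (apply Fin.ext; omega)

lemma sum_cnt {G : SimpleGraph V} [Fintype G.edgeSet] {u v : V} (w : G.Walk u v)
    (κ : Fin w.length → ℤˣ) (f : G.edgeSet → ℤ) :
    ∑ e, f e * ((cnt w κ 1 e : ℤ) - cnt w κ (-1) e) = ∑ i, f (edgeAt w i) * κ i := by
  have h : ∀ e, f e * ((cnt w κ 1 e : ℤ) - cnt w κ (-1) e)
      = ∑ i, if edgeAt w i = e then f (edgeAt w i) * κ i else 0 := by
    intro e
    unfold cnt
    push_cast
    rw [← Finset.sum_sub_distrib, Finset.mul_sum]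
    refine Finset.sum_congr rfl fun i _ => ?_
    by_cases he : edgeAt w i = e
    · rcases Int.units_eq_one_or (κ i) with hk | hk <;> simp [hk, he]
    · simp [he]
  simp_rw [h]
  rw [Finset.sum_comm]
  simp

lemma flip_kernel {G : SimpleGraph V} [Fintype G.edgeSet] (τ : Sym2 V → V → ℤˣ) {v : V}
    (w : G.Walk v v) (κ : Fin w.length → ℤˣ) (hκ : FlipRel G τ w κ) (x : V) :
    ∑ e, inc τ x e * ((cnt w κ 1 e : ℤ) - cnt w κ (-1) e) = 0 := by
  rw [sum_cnt]
  simp_rw [inc_edgeAt, add_mul]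
  rw [Finset.sum_add_distrib, ← csucc_bij.sum_comp, ← Finset.sum_add_distrib]
  refine Finset.sum_eq_zero fun i _ => ?_
  rw [hκ i, dart_csucc]
  by_cases hx : x = (dartAt w i).snd
  · simp only [hx, if_true]
    rcases Int.units_eq_one_or (τ (dartAt w i).edge (dartAt w i).snd) with h1 | h1 <;>
    rcases Int.units_eq_one_or (τ (dartAt w (csucc i)).edge (dartAt w i).snd) with h2 | h2 <;>
    simp [h1, h2]
  · simp [hx]

lemma kap_succ {G : SimpleGraph V} (τ : Sym2 V → V → ℤˣ) {u v : V} (w : G.Walk u v) :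
    ∀ (s : ℤˣ) (i j : Fin w.length), (j : ℕ) = i + 1 →
      kap G τ s w j = -(τ (dartAt w i).edge (dartAt w i).toProd.2 *
          τ (dartAt w j).edge (dartAt w i).toProd.2) * kap G τ s w i := by
  induction w with
  | nil => intro s i; exact i.elim0
  | @cons a b c h p ih =>
    intro s i j hij
    obtain ⟨j, hj⟩ := j
    obtain ⟨i, hi⟩ := i
    simp only at hij
    subst hij
    cases i with
    | succ i => exact ih _ ⟨i, by simpa using hi⟩ ⟨i + 1, by simpa using hj⟩ rfl
    | zero =>
      cases p with
      | nil => simp at hj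
      | @cons _ d _ h' q =>
        change -(s * τ s(a, b) a * τ s(a, b) b) * τ s(b, d) b =
          -(τ s(a, b) b * τ s(b, d) b) * (s * τ s(a, b) a)
        simp only [neg_mul, neg_inj]
        ac_rfl

lemma kap_zero {G : SimpleGraph V} (τ : Sym2 V → V → ℤˣ) {u v : V} (w : G.Walk u v)
    (s : ℤˣ) (i : Fin w.length) (hi : (i : ℕ) = 0) :
    kap G τ s w i = s * τ (dartAt w i).edge u := by
  cases w with
  | nil => exact i.elim0
  | @cons a b c h p =>
    obtain ⟨i, hi'⟩ := i
    simp only at hi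
    subst hi
    rfl

lemma mu_cons {G : SimpleGraph V} (τ : Sym2 V → V → ℤˣ) {a b c : V} (h : G.Adj a b)
    (p : G.Walk b c) :
    mu G τ (SimpleGraph.Walk.cons h p) = -(τ s(a, b) a * τ s(a, b) b) * mu G τ p := by
  simp only [mu, walkSign, SimpleGraph.Walk.length_cons, pow_succ]
  rcases Int.units_eq_one_or (τ s(a, b) a) with h1 | h1 <;>
  rcases Int.units_eq_one_or (τ s(a, b) b) with h2 | h2 <;> simp [h1, h2]

lemma kap_last {G : SimpleGraph V} (τ : Sym2 V → V → ℤˣ) {u v : V} (w : G.Walk u v) :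
    ∀ (s : ℤˣ) (i : Fin w.length), (i : ℕ) + 1 = w.length →
      kap G τ s w i = -(s * mu G τ w) * τ (dartAt w i).edge v := by
  induction w with
  | nil => intro s i; exact i.elim0
  | @cons a b c h p ih =>
    intro s i hi
    obtain ⟨i, hi'⟩ := i
    simp only at hi
    rw [mu_cons]
    cases i with
    | succ i =>
      refine (ih _ ⟨i, by simpa using hi'⟩ (by simpa using hi)).trans ?_
      change _ = _ * τ (dartAt p ⟨i, by simpa using hi'⟩).edge c
      congr 2
      simp only [neg_mul, mul_neg]
      ac_rfl
    | zero =>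
      cases p with
      | cons h' q => simp at hi
      | nil =>
        change s * τ s(a, b) a = -(s * (-(τ s(a, b) a * τ s(a, b) b) * mu G τ SimpleGraph.Walk.nil))
          * τ s(a, b) b
        rcases Int.units_eq_one_or (τ s(a, b) b) with h2 | h2 <;> simp [h2, mu, walkSign]

lemma kap_flip {G : SimpleGraph V} (τ : Sym2 V → V → ℤˣ) {v : V} (w : G.Walk v v) (s : ℤˣ)
    (hmu : mu G τ w = 1) : FlipRel G τ w (kap G τ s w) := by
  intro i
  rcases csucc_cases i with h | ⟨h, h'⟩
  · exact kap_succ τ w s _ _ h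
  · rw [kap_zero τ w s _ h', kap_last τ w s _ h, hmu, dart_last w i h]
    rcases Int.units_eq_one_or (τ (dartAt w i).edge v) with h2 | h2 <;>
      simp [h2, mul_comm]

lemma cnt_cons {G : SimpleGraph V} (τ : Sym2 V → V → ℤˣ) {a b c : V} (h : G.Adj a b)
    (p : G.Walk b c) (s ε : ℤˣ) (e : G.edgeSet) :
    cnt (SimpleGraph.Walk.cons h p) (kap G τ s (SimpleGraph.Walk.cons h p)) ε e =
      (if s * τ s(a, b) a = ε ∧ (⟨s(a, b), h⟩ : G.edgeSet) = e then 1 else 0) +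
      cnt p (kap G τ (-(s * τ s(a, b) a * τ s(a, b) b)) p) ε e :=
  Fin.sum_univ_succ (n := p.length) _

/-- Conformality of a signed walk with an integer vector. -/
def Conf {G : SimpleGraph V} {u v : V} (w : G.Walk u v) (κ : Fin w.length → ℤˣ)
    (r : G.edgeSet → ℤ) : Prop :=
  ∀ e, cnt w κ 1 e ≤ (r e).toNat ∧ cnt w κ (-1) e ≤ (-(r e)).toNat

lemma conf_cons {G : SimpleGraph V} (τ : Sym2 V → V → ℤˣ) {a b c : V} (h : G.Adj a b)
    (p : G.Walk b c) (s : ℤˣ) (r : G.edgeSet → ℤ)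
    (hr : 0 < r ⟨s(a, b), h⟩ * (s * τ s(a, b) a : ℤˣ))
    (hp : Conf p (kap G τ (-(s * τ s(a, b) a * τ s(a, b) b)) p)
      (r - Pi.single ⟨s(a, b), h⟩ ((s * τ s(a, b) a : ℤˣ) : ℤ))) :
    Conf (SimpleGraph.Walk.cons h p) (kap G τ s (SimpleGraph.Walk.cons h p)) r := by
  intro e
  have := hp e
  rw [cnt_cons, cnt_cons]
  by_cases he : (⟨s(a, b), h⟩ : G.edgeSet) = e
  · subst he
    simp only [Pi.sub_apply, Pi.single_eq_same] at this
    rcases Int.units_eq_one_or (s * τ s(a, b) a) with h2 | h2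
    · rw [h2] at this hr ⊢
      simp at this hr ⊢
      omega
    · rw [h2] at this hr ⊢
      simp at this hr ⊢
      omega
  · simp only [Pi.sub_apply, Pi.single_eq_of_ne (Ne.symm he)] at this
    simpa [he] using this

lemma inc_single {G : SimpleGraph V} [Fintype G.edgeSet] (τ : Sym2 V → V → ℤˣ) (x a b : V)
    (h : G.Adj a b) (r : G.edgeSet → ℤ) (k : ℤ) :
    ∑ e, inc τ x e * (r - Pi.single ⟨s(a, b), h⟩ k : G.edgeSet → ℤ) e =
      ∑ e, inc τ x e * r e - ((if x = a then (τ s(a, b) a : ℤ) else 0) +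
        (if x = b then (τ s(a, b) b : ℤ) else 0)) * k := by
  rw [← inc_mk τ x a b h]
  simp [mul_sub, Finset.sum_sub_distrib, Pi.single_apply]

lemma norm_single {G : SimpleGraph V} [Fintype G.edgeSet] (e : G.edgeSet)
    (r : G.edgeSet → ℤ) (k : ℤˣ) (hr : 0 < r e * k) :
    ∑ f, ((r - Pi.single e (k : ℤ) : G.edgeSet → ℤ) f).natAbs < ∑ f, (r f).natAbs := by
  apply Finset.sum_lt_sum
  · intro f _
    by_cases hf : f = e
    · subst hf
      rcases Int.units_eq_one_or k with h2 | h2 <;> rw [h2] at hr ⊢ <;> simp at hr ⊢ <;> omega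
    · simp [hf]
  · refine ⟨e, Finset.mem_univ _, ?_⟩
    rcases Int.units_eq_one_or k with h2 | h2 <;> rw [h2] at hr ⊢ <;> simp at hr ⊢ <;> omega

lemma exists_walk {G : SimpleGraph V} [Fintype G.edgeSet] (τ : Sym2 V → V → ℤˣ) (a : V) (t : ℤˣ)
    (N : ℕ) : ∀ (r : G.edgeSet → ℤ) (u : V) (s : ℤˣ), ∑ e, (r e).natAbs = N →
      (∀ x, ∑ e, inc τ x e * r e =
        (if x = u then (s : ℤ) else 0) - (if x = a then (t : ℤ) else 0)) →
      ∃ w : G.Walk u a, s * mu G τ w = t ∧ Conf w (kap G τ s w) r := by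
  induction N using Nat.strong_induction_on with
  | _ N ih =>
  intro r u s hN hr
  by_cases hend : u = a ∧ s = t
  · obtain ⟨rfl, rfl⟩ := hend
    refine ⟨SimpleGraph.Walk.nil, by simp [mu, walkSign], ?_⟩
    intro e
    have h0 : ∀ ε, cnt (SimpleGraph.Walk.nil : G.Walk u u) (kap G τ s SimpleGraph.Walk.nil) ε e = 0 :=
      fun ε => Fin.sum_univ_zero _
    simp [h0]
  have hpos : 0 < (∑ e, inc τ u e * r e) * (s : ℤ) := by
    rw [hr u]
    by_cases hu : u = a
    · have hst : s ≠ t := fun h => hend ⟨hu, h⟩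
      rcases Int.units_eq_one_or s with h1 | h1 <;> rcases Int.units_eq_one_or t with h2 | h2 <;>
        simp [h1, h2, hu] at hst ⊢
    · rcases Int.units_eq_one_or s with h1 | h1 <;> simp [h1, hu]
  rw [Finset.sum_mul] at hpos
  obtain ⟨e, -, he⟩ := Finset.exists_lt_of_sum_lt
    (f := fun _ => (0 : ℤ)) (s := Finset.univ) (by simpa using hpos)
  have hue : u ∈ (e : Sym2 V) := by
    by_contra hne
    simp [inc, hne] at he
  obtain ⟨e, hadj⟩ := e
  obtain ⟨v, rfl⟩ : ∃ v, e = s(u, v) := Sym2.mem_iff_exists.1 hue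
  have hadj' : G.Adj u v := hadj
  have hre : 0 < r ⟨s(u, v), hadj'⟩ * (s * τ s(u, v) u : ℤˣ) := by
    simp only [inc, hue, if_true] at he
    push_cast
    linarith
  have hlt := norm_single _ r _ hre
  rw [hN] at hlt
  obtain ⟨w, hw, hc⟩ := ih _ hlt _ v (-(s * τ s(u, v) u * τ s(u, v) v)) rfl (by
    intro x
    rw [inc_single τ x u v hadj', hr x]
    by_cases hxu : x = u <;> by_cases hxv : x = v <;>
    rcases Int.units_eq_one_or (τ s(u, v) u) with h1 | h1 <;>
    simp [hxu, hxv, h1] <;> split_ifs <;> ring)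
  refine ⟨SimpleGraph.Walk.cons hadj' w, ?_, conf_cons τ hadj' w s r hre hc⟩
  rw [← hw, mu_cons]
  simp only [neg_mul, mul_neg, neg_inj]
  ac_rfl

lemma exists_closed {G : SimpleGraph V} [Fintype G.edgeSet] (τ : Sym2 V → V → ℤˣ)
    (r : G.edgeSet → ℤ) (hr : ∀ x, ∑ e, inc τ x e * r e = 0) (hne : r ≠ 0) :
    ∃ (v : V) (w : G.Walk v v) (κ : Fin w.length → ℤˣ),
      mu G τ w = 1 ∧ FlipRel G τ w κ ∧ Conf w κ r ∧
      ∃ e, 0 < cnt w κ 1 e + cnt w κ (-1) e := by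
  obtain ⟨⟨e, hadj⟩, he⟩ := Function.ne_iff.1 hne
  induction e using Sym2.ind with
  | _ a v =>
  change G.Adj a v at hadj
  obtain ⟨k, hk⟩ : ∃ k : ℤˣ, 0 < r ⟨s(a, v), hadj⟩ * k := by
    rcases lt_or_gt_of_ne he with h | h
    · exact ⟨-1, by simpa using h⟩
    · exact ⟨1, by simpa using h⟩
  obtain ⟨s, rfl⟩ : ∃ s, k = s * τ s(a, v) a := ⟨k * τ s(a, v) a, by
    rw [mul_assoc, Int.units_mul_self, mul_one]⟩
  obtain ⟨w, hw, hc⟩ := exists_walk τ a s _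
    (r - Pi.single ⟨s(a, v), hadj⟩ ((s * τ s(a, v) a : ℤˣ) : ℤ)) v
    (-(s * τ s(a, v) a * τ s(a, v) v)) rfl (by
    intro x
    rw [inc_single, hr x]
    by_cases hxu : x = a <;> by_cases hxv : x = v <;>
    rcases Int.units_eq_one_or (τ s(a, v) a) with h1 | h1 <;>
    simp [hxu, hxv, h1] <;> split_ifs <;> ring)
  have hmu : mu G τ (SimpleGraph.Walk.cons hadj w) = 1 := by
    have : s * mu G τ (SimpleGraph.Walk.cons hadj w) = s * 1 := by
      rw [mul_one]
      refine Eq.trans ?_ hw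
      rw [mu_cons]
      simp only [neg_mul, mul_neg, neg_inj]
      ac_rfl
    exact mul_left_cancel this
  refine ⟨a, _, _, hmu, kap_flip τ _ s hmu, conf_cons τ hadj w s r hk hc, ⟨s(a, v), hadj⟩, ?_⟩
  rw [cnt_cons, cnt_cons]
  rcases Int.units_eq_one_or (s * τ s(a, v) a) with h2 | h2 <;> rw [h2] <;> simp

open MvPolynomial in
lemma mem_span (K : Type*) [Field K] {G : SimpleGraph V} [Fintype G.edgeSet]
    (τ : Sym2 V → V → ℤˣ) (N : ℕ) : ∀ b : G.edgeSet → ℤ, ∑ e, (b e).natAbs = N →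
    (∀ x, ∑ e, inc τ x e * b e = 0) →
    ((∏ e : G.edgeSet, X e ^ (b e).toNat) - ∏ e : G.edgeSet, X e ^ (-(b e)).toNat :
        MvPolynomial G.edgeSet K) ∈
      Ideal.span { f | ∃ (v : V) (w : G.Walk v v) (κ : Fin w.length → ℤˣ),
        mu G τ w = 1 ∧ FlipRel G τ w κ ∧ f = Bpos K w κ - Bneg K w κ } := by
  induction N using Nat.strong_induction_on with
  | _ N ih =>
  intro b hN hb
  by_cases hne : b = 0
  · subst hne
    simp
  obtain ⟨v, w, κ, hmu, hfl, hc, e₀, he₀⟩ := exists_closed τ b hb hne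
  set b' : G.edgeSet → ℤ := fun e => b e - ((cnt w κ 1 e : ℤ) - cnt w κ (-1) e) with hb'
  have hlt : ∑ e, (b' e).natAbs < N := by
    rw [← hN]
    apply Finset.sum_lt_sum
    · intro e _
      have := hc e
      simp only [hb']
      omega
    · refine ⟨e₀, Finset.mem_univ _, ?_⟩
      have := hc e₀
      simp only [hb']
      omega
  have hmem := ih _ hlt b' rfl (by
    intro x
    simp only [hb']
    simp_rw [mul_sub (inc τ x _) (b _)]
    rw [Finset.sum_sub_distrib, hb, flip_kernel τ w κ hfl, sub_zero])
  have hp : (∏ e : G.edgeSet, X e ^ (b e).toNat : MvPolynomial G.edgeSet K) =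
      Bpos K w κ * ∏ e : G.edgeSet, X e ^ (b' e).toNat := by
    rw [show Bpos K w κ = _ from prod_eq_cnt K w κ 1, ← Finset.prod_mul_distrib]
    refine Finset.prod_congr rfl fun e _ => ?_
    rw [← pow_add]
    congr 1
    have := hc e
    simp only [hb']
    omega
  have hn : (∏ e : G.edgeSet, X e ^ (-(b e)).toNat : MvPolynomial G.edgeSet K) =
      Bneg K w κ * ∏ e : G.edgeSet, X e ^ (-(b' e)).toNat := by
    rw [show Bneg K w κ = _ from prod_eq_cnt K w κ (-1), ← Finset.prod_mul_distrib]
    refine Finset.prod_congr rfl fun e _ => ?_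
    rw [← pow_add]
    congr 1
    have := hc e
    simp only [hb']
    omega
  rw [hp, hn]
  have hB : Bpos K w κ - Bneg K w κ ∈ Ideal.span { f | ∃ (v : V) (w : G.Walk v v)
        (κ : Fin w.length → ℤˣ),
        mu G τ w = 1 ∧ FlipRel G τ w κ ∧ f = Bpos K w κ - Bneg K w κ } :=
    Ideal.subset_span ⟨v, w, κ, hmu, hfl, rfl⟩
  have := Ideal.add_mem _ (Ideal.mul_mem_right (∏ e : G.edgeSet, X e ^ (b' e).toNat) _ hB)
    (Ideal.mul_mem_left _ (Bneg K w κ) hmem)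
  convert this using 1
  ring

end Helpers

open MvPolynomial in
/-- The toric ideal I_{(G,τ)} of a signed graph is generated by the
binomials B_w = B_w⁺ - B_w⁻ associated with the even closed walks w of (G,τ). -/
theorem toricIdeal_eq_span_even_walks [DecidableEq V] (K : Type*) [Field K]
    (G : SimpleGraph V) [Fintype G.edgeSet] (τ : Sym2 V → V → ℤˣ) :
    toricIdeal K G τ =
      Ideal.span { f | ∃ (v : V) (w : G.Walk v v) (κ : Fin w.length → ℤˣ),
        mu G τ w = 1 ∧ FlipRel G τ w κ ∧ f = Bpos K w κ - Bneg K w κ } := by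
  apply le_antisymm
  · refine Ideal.span_le.2 ?_
    rintro f ⟨b, hb, rfl⟩
    exact mem_span K τ _ b rfl hb
  · refine Ideal.span_le.2 ?_
    rintro f ⟨v, w, κ, -, hfl, rfl⟩
    set b : G.edgeSet → ℤ := fun e => (cnt w κ 1 e : ℤ) - cnt w κ (-1) e with hb
    have hmem : (∏ e : G.edgeSet, X e ^ (b e).toNat) - ∏ e : G.edgeSet, X e ^ (-(b e)).toNat
        ∈ toricIdeal K G τ :=
      Ideal.subset_span ⟨b, flip_kernel τ w κ hfl, rfl⟩
    have := Ideal.mul_mem_left _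
      (∏ e : G.edgeSet, X e ^ (min (cnt w κ 1 e) (cnt w κ (-1) e))) hmem
    change Bpos K w κ - Bneg K w κ ∈ toricIdeal K G τ
    convert this using 1
    rw [mul_sub, show Bpos K w κ = _ from prod_eq_cnt K w κ 1,
      show Bneg K w κ = _ from prod_eq_cnt K w κ (-1),
      ← Finset.prod_mul_distrib, ← Finset.prod_mul_distrib]
    congr 1 <;>
    · refine Finset.prod_congr rfl fun e _ => ?_
      rw [← pow_add]
      congr 1
      simp only [hb]
      omega
end

section
/- Let b be a nonzero integer vector in the kernel of the incidence matrix A(G,τ) of a signed graph, and let G_b be the multigraph with |b_e| copies of each edge e (signs copied). Then every connected component D of G_b admits an Eulerian closed walk w_D which is an even closed walk in (G,τ), and the binomial e^{b⁺} − e^{b⁻} factors as ∏_D B_{w_D}⁺ − ∏_D B_{w_D}⁻ over the connected components D of G_b. -/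
variable {V : Type*}

/-- consecutive darts leave with opposite half-edge signs -/
def altRel (G : SimpleGraph V) (σ : Sym2 V → V → ℤˣ) (d d' : G.Dart) : Prop :=
  σ d.edge d.toProd.2 = - σ d'.edge d.toProd.2

/-- signed degree of a multiplicity function at a vertex -/
def sdeg [DecidableEq V] (G : SimpleGraph V) [Fintype G.edgeSet] (σ : Sym2 V → V → ℤˣ)
    (m : G.edgeSet → ℤ) (v : V) : ℤ :=
  ∑ e : G.edgeSet, (if v ∈ (e : Sym2 V) then (σ e v : ℤ) else 0) * m e

lemma sdeg_cons [DecidableEq V] (G : SimpleGraph V) [Fintype G.edgeSet] (σ : Sym2 V → V → ℤˣ)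
    {u a v : V} (h : G.Adj u a) (p : G.Walk a v) (x : V) :
    sdeg G σ (fun e => ((SimpleGraph.Walk.cons h p).edges.count (e : Sym2 V) : ℤ)) x =
    (if x = u then (σ s(u,a) u : ℤ) else 0) + (if x = a then (σ s(u,a) a : ℤ) else 0) +
    sdeg G σ (fun e => (p.edges.count (e : Sym2 V) : ℤ)) x := by
  unfold sdeg
  have h1 : ∀ e : G.edgeSet, (((SimpleGraph.Walk.cons h p).edges.count (e : Sym2 V) : ℕ) : ℤ)
      = (if e = ⟨s(u,a), h⟩ then 1 else 0) + (p.edges.count (e : Sym2 V) : ℤ) := by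
    intro e
    rw [SimpleGraph.Walk.edges_cons, List.count_cons]
    have : (s(u,a) == (e : Sym2 V)) = true ↔ e = ⟨s(u,a), h⟩ := by
      rw [beq_iff_eq, Subtype.ext_iff]; exact eq_comm
    simp only [this]
    push_cast
    ring
  simp only [h1, mul_add, Finset.sum_add_distrib, mul_ite, mul_one, mul_zero]
  congr 1
  rw [Finset.sum_ite_eq']
  simp only [Finset.mem_univ, if_true, Sym2.mem_iff]
  have := h.ne
  by_cases hu : x = u <;> by_cases ha : x = a <;> simp_all

lemma chain_walk [DecidableEq V] (G : SimpleGraph V) [Fintype G.edgeSet] (σ : Sym2 V → V → ℤˣ)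
    {a v : V} (p : G.Walk a v) : ∀ {u : V} (h : G.Adj u a),
    List.IsChain (altRel G σ) (SimpleGraph.Walk.cons h p).darts →
    ∃ ε : ℤˣ, (∀ d ∈ (SimpleGraph.Walk.cons h p).darts.getLast?, σ d.edge d.toProd.2 = ε ∧
        d.toProd.2 = v) ∧
      mu G σ (SimpleGraph.Walk.cons h p) = - (σ s(u,a) u * ε) ∧
      ∀ x, sdeg G σ (fun e => ((SimpleGraph.Walk.cons h p).edges.count (e : Sym2 V) : ℤ)) x =
        (if x = u then (σ s(u,a) u : ℤ) else 0) + (if x = v then (ε : ℤ) else 0) := by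
  induction p with
  | @nil a =>
    intro u h _
    refine ⟨σ s(u,a) a, ?_, ?_, ?_⟩
    · simp [SimpleGraph.Dart.edge]
    · simp [mu, walkSign]
    · intro x
      rw [sdeg_cons]
      simp [sdeg]
  | @cons a c v h' p ih =>
    intro u h hc
    rw [SimpleGraph.Walk.darts_cons, SimpleGraph.Walk.darts_cons, List.isChain_cons_cons] at hc
    obtain ⟨hr, hc⟩ := hc
    obtain ⟨ε, h1, h2, h3⟩ := ih h' (by simpa using hc)
    have hr' : σ s(u,a) a = - σ s(a,c) a := hr
    refine ⟨ε, ?_, ?_, ?_⟩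
    · intro d hd
      apply h1
      simpa [SimpleGraph.Walk.darts_cons, List.getLast?_cons_cons] using hd
    · have : mu G σ (SimpleGraph.Walk.cons h (SimpleGraph.Walk.cons h' p)) =
        - (σ s(u,a) u * σ s(u,a) a) * mu G σ (SimpleGraph.Walk.cons h' p) := by
        conv_lhs => rw [mu, walkSign, SimpleGraph.Walk.length_cons, pow_succ]
        rw [mu]
        simp only [mul_neg, mul_one, neg_mul]
        congr 1
        ac_rfl
      rw [this, h2, hr']
      have := Int.units_mul_self (σ s(a,c) a)
      generalize σ s(a,c) a = t1
      generalize σ s(u,a) u = t2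
      clear * -
      revert t1 t2 ε
      decide
    · intro x
      rw [sdeg_cons, h3, hr']
      push_cast
      split_ifs <;> simp_all

lemma sdeg_const [DecidableEq V] (G : SimpleGraph V) [Fintype G.edgeSet] (σ : Sym2 V → V → ℤˣ)
    (m : G.edgeSet → ℤ) (u : V) (δ : ℤˣ) (hm : ∀ e, 0 ≤ m e)
    (h : ∀ e : G.edgeSet, u ∈ (e : Sym2 V) → 0 < m e → σ e u = δ) :
    (δ : ℤ) * sdeg G σ m u = ∑ e : G.edgeSet, if u ∈ (e : Sym2 V) then m e else 0 := by
  unfold sdeg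
  rw [Finset.mul_sum]
  apply Finset.sum_congr rfl
  intro e _
  split_ifs with hu
  · rcases (hm e).eq_or_lt with h0 | h0
    · simp [← h0]
    · rw [h e hu h0, ← mul_assoc]
      have := Int.units_mul_self δ
      rw [← Units.val_mul, this]; simp
  · simp

lemma length_le [DecidableEq V] (G : SimpleGraph V) [Fintype G.edgeSet] {u v : V}
    (w : G.Walk u v) : w.length = ∑ e : G.edgeSet, w.edges.count (e : Sym2 V) := by
  induction w with
  | nil => simp
  | @cons u a v h p ih =>
    simp only [SimpleGraph.Walk.edges_cons, SimpleGraph.Walk.length_cons, List.count_cons,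
      Finset.sum_add_distrib, ih]
    congr 1
    rw [Finset.sum_eq_single (⟨s(u,a), h⟩ : G.edgeSet)]
    · simp
    · intro e _ he
      rw [if_neg]
      intro h'
      exact he (Subtype.ext (by simpa using (beq_iff_eq.1 h').symm))
    · simp

lemma prod_dartAt [DecidableEq V] {M : Type*} [CommMonoid M] (G : SimpleGraph V)
    [Fintype G.edgeSet] {u v : V} (w : G.Walk u v) (f : G.edgeSet → M) :
    ∏ i, f ⟨(dartAt w i).edge, (dartAt w i).edge_mem⟩ =
      ∏ e : G.edgeSet, f e ^ w.edges.count (e : Sym2 V) := by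
  induction w with
  | nil =>
    simp only [SimpleGraph.Walk.edges_nil, List.count_nil, pow_zero, Finset.prod_const_one]
    exact Fin.prod_univ_zero _
  | @cons u a v h p ih =>
    simp only [SimpleGraph.Walk.edges_cons, List.count_cons, pow_add, Finset.prod_mul_distrib]
    rw [← ih]
    have e1 : ∏ e : G.edgeSet, f e ^ (if (s(u,a) == (e : Sym2 V)) = true then 1 else 0)
        = f ⟨s(u,a), h⟩ := by
      rw [Finset.prod_eq_single (⟨s(u,a), h⟩ : G.edgeSet)]
      · simp
      · intro e _ he
        rw [if_neg, pow_zero]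
        intro h'
        exact he (Subtype.ext (by simpa using (beq_iff_eq.1 h').symm))
      · simp
    rw [e1, mul_comm]
    exact Fin.prod_univ_succ (n := p.length)
      (fun i => f ⟨(dartAt (SimpleGraph.Walk.cons h p) i).edge,
        (dartAt (SimpleGraph.Walk.cons h p) i).edge_mem⟩)

lemma cycle_chain_get {α : Type*} (r : α → α → Prop) (l : List α)
    (h : Cycle.Chain r (l : Cycle α)) (i : ℕ) (hi : i < l.length) :
    r l[i] (l[(i+1) % l.length]'(Nat.mod_lt _ (by omega))) := by
  cases l with
  | nil => simp at hi
  | cons a l =>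
    rw [Cycle.chain_coe_cons] at h
    have := List.isChain_iff_getElem.1 h i (by simpa using hi)
    rcases Nat.lt_or_ge i l.length with h1 | h1
    · have e : (i+1) % (a :: l).length = i + 1 := Nat.mod_eq_of_lt (by simpa using h1)
      simp only [e]
      grind
    · have : i = l.length := by simp at hi; omega
      subst this
      have e : (l.length+1) % (a :: l).length = 0 := by simp
      simp only [e]
      grind

lemma closed_chain {G : SimpleGraph V} (σ : Sym2 V → V → ℤˣ) {u a v : V} (h : G.Adj u a)
    (p : G.Walk a v)
    (hc : List.IsChain (altRel G σ) (SimpleGraph.Walk.cons h p).darts)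
    (hl : ∀ d ∈ (SimpleGraph.Walk.cons h p).darts.getLast?,
      σ d.edge d.toProd.2 = - σ s(u,a) u ∧ d.toProd.2 = u) :
    Cycle.Chain (altRel G σ) ((SimpleGraph.Walk.cons h p).darts : Cycle G.Dart) := by
  rw [SimpleGraph.Walk.darts_cons] at *
  rw [Cycle.chain_coe_cons, ← List.cons_append, List.isChain_append]
  refine ⟨hc, by simp, ?_⟩
  intro d hd d' hd'
  simp at hd'
  subst hd'
  obtain ⟨h1, h2⟩ := hl d hd
  unfold altRel
  rw [h1, h2]
  rfl

lemma chain_of_cycle {α : Type*} (r : α → α → Prop) (l : List α)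
    (h : Cycle.Chain r (l : Cycle α)) : List.IsChain r l := by
  cases l with
  | nil => simp
  | cons a l =>
    rw [Cycle.chain_coe_cons, ← List.cons_append, List.isChain_append] at h
    exact h.1

/-- An alternating walk bounded by the multiplicities can be extended by a residual edge. -/
lemma extend_walk [DecidableEq V] (G : SimpleGraph V) [Fintype G.edgeSet] (σ : Sym2 V → V → ℤˣ)
    (c : G.edgeSet → ℕ) {u a v : V} (h : G.Adj u a) (p : G.Walk a v)
    (hc : List.IsChain (altRel G σ) (SimpleGraph.Walk.cons h p).darts)
    (hle : ∀ e : G.edgeSet, (SimpleGraph.Walk.cons h p).edges.count (e : Sym2 V) ≤ c e)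
    (e : G.edgeSet) (hu : u ∈ (e : Sym2 V))
    (he : (SimpleGraph.Walk.cons h p).edges.count (e : Sym2 V) < c e)
    (hs : σ e u = - σ s(u,a) u) :
    ∃ (y : V) (w : G.Walk y v), w.length = (SimpleGraph.Walk.cons h p).length + 1 ∧
      List.IsChain (altRel G σ) w.darts ∧
      ∀ e : G.edgeSet, w.edges.count (e : Sym2 V) ≤ c e := by
  obtain ⟨e, hG⟩ := e
  obtain ⟨y, rfl⟩ := Sym2.mem_iff_exists.1 hu
  have hy : G.Adj y u := SimpleGraph.Adj.symm hG
  refine ⟨y, SimpleGraph.Walk.cons hy (SimpleGraph.Walk.cons h p), rfl, ?_, ?_⟩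
  · rw [SimpleGraph.Walk.darts_cons, SimpleGraph.Walk.darts_cons, List.isChain_cons_cons]
    refine ⟨?_, by simpa using hc⟩
    change σ s(y,u) u = - σ s(u,a) u
    rw [Sym2.eq_swap]; exact hs
  · intro e'
    rw [SimpleGraph.Walk.edges_cons, List.count_cons]
    split_ifs with h'
    · have : e' = ⟨s(u,y), hG⟩ := Subtype.ext (by rw [← beq_iff_eq.1 h', Sym2.eq_swap])
      subst this
      exact he
    · exact hle e'

lemma sdeg_sub [DecidableEq V] (G : SimpleGraph V) [Fintype G.edgeSet] (σ : Sym2 V → V → ℤˣ)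
    (m m' : G.edgeSet → ℤ) (v : V) :
    sdeg G σ (fun e => m e - m' e) v = sdeg G σ m v - sdeg G σ m' v := by
  simp [sdeg, mul_sub]

lemma exists_component [DecidableEq V] (G : SimpleGraph V) [Fintype G.edgeSet]
    (σ : Sym2 V → V → ℤˣ) (c : G.edgeSet → ℕ) (hc0 : ∃ e, 0 < c e)
    (hbal : ∀ v, sdeg G σ (fun e => (c e : ℤ)) v = 0) :
    ∃ (x : V) (w : G.Walk x x), 0 < w.length ∧ mu G σ w = 1 ∧
      Cycle.Chain (altRel G σ) (w.darts : Cycle G.Dart) ∧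
      (∀ e : G.edgeSet, w.edges.count (e : Sym2 V) ≤ c e) ∧
      (∀ v, sdeg G σ (fun e => (w.edges.count (e : Sym2 V) : ℤ)) v = 0) ∧
      (∀ e : G.edgeSet, w.edges.count (e : Sym2 V) < c e →
        ∀ y ∈ (e : Sym2 V), y ∉ w.support) := by
  let S : Set ℕ := {n | ∃ (u v : V) (w : G.Walk u v), w.length = n ∧
    List.IsChain (altRel G σ) w.darts ∧ ∀ e : G.edgeSet, w.edges.count (e : Sym2 V) ≤ c e}
  have hS1 : 1 ∈ S := by
    obtain ⟨⟨e, he⟩, hce⟩ := hc0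
    induction e with
    | _ u v =>
    have ha : G.Adj u v := he
    refine ⟨u, v, SimpleGraph.Walk.cons ha SimpleGraph.Walk.nil, rfl, by simp, ?_⟩
    intro e'
    rw [SimpleGraph.Walk.edges_cons, List.count_cons]
    split_ifs with h'
    · have : e' = ⟨s(u,v), he⟩ := Subtype.ext (by rw [← beq_iff_eq.1 h'])
      subst this
      simpa [Nat.one_le_iff_ne_zero, Nat.pos_iff_ne_zero] using hce
    · simp
  have hSb : BddAbove S := by
    refine ⟨∑ e, c e, ?_⟩
    rintro n ⟨u, v, w, rfl, _, h⟩
    rw [length_le]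
    exact Finset.sum_le_sum fun e _ => h e
  have hmem : sSup S ∈ S := Nat.sSup_mem ⟨1, hS1⟩ hSb
  have hmax : ∀ n ∈ S, n ≤ sSup S := fun n hn => le_csSup hSb hn
  have hpos : 1 ≤ sSup S := hmax 1 hS1
  generalize sSup S = N at *
  obtain ⟨u, v, w, hN, hch, hle⟩ := hmem
  cases w with
  | nil => simp at hN; omega
  | @cons _ a _ h p =>
  obtain ⟨ε, h1, h2, h3⟩ := chain_walk G σ p h hch
  have key : u = v ∧ ε = - σ s(u,a) u := by
    by_contra hne
    have hno : ∀ e : G.edgeSet, u ∈ (e : Sym2 V) →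
        0 < (c e : ℤ) - ((SimpleGraph.Walk.cons h p).edges.count (e : Sym2 V) : ℤ) →
        σ e u = σ s(u,a) u := by
      intro e hu he
      by_contra hs
      have hs' : σ e u = - σ s(u,a) u := by
        rcases Int.units_eq_one_or (σ e u) with h | h <;>
        rcases Int.units_eq_one_or (σ s(u,a) u) with h' | h' <;> simp_all
      obtain ⟨y, w', hw, hw2, hw3⟩ := extend_walk G σ c h p hch hle e hu (by omega) hs'
      have := hmax _ ⟨y, v, w', rfl, hw2, hw3⟩
      omega
    have hd := sdeg_const G σ _ u (σ s(u,a) u) (fun e => by have := hle e; omega) hno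
    rw [sdeg_sub, hbal, h3] at hd
    have hnn : (0:ℤ) ≤ ∑ e : G.edgeSet, if u ∈ (e : Sym2 V) then
        (c e : ℤ) - ((SimpleGraph.Walk.cons h p).edges.count (e : Sym2 V) : ℤ) else 0 := by
      apply Finset.sum_nonneg
      intro e _
      have := hle e
      split_ifs <;> omega
    rw [← hd] at hnn
    clear hd hno h1 h2 h3
    generalize σ s(u,a) u = t at *
    by_cases huv : u = v
    · rcases Int.units_eq_one_or ε with h | h <;>
      rcases Int.units_eq_one_or t with h' | h' <;> simp [huv, h, h'] at hne hnn
    · rcases Int.units_eq_one_or t with h' | h' <;> simp [huv, h'] at hnn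
  obtain ⟨rfl, rfl⟩ := key
  have hcyc := closed_chain σ h p hch h1
  have hz : ∀ v, sdeg G σ
      (fun e => ((SimpleGraph.Walk.cons h p).edges.count (e : Sym2 V) : ℤ)) v = 0 := by
    intro x
    rw [h3]
    split_ifs <;> simp
  refine ⟨u, _, by simp, ?_, hcyc, hle, hz, ?_⟩
  · rw [h2]
    simp
  · intro e he y hy hys
    generalize hw : SimpleGraph.Walk.cons h p = w at *
    have hrot : (w.rotate y hys).darts ~r w.darts := w.rotate_darts y hys
    have hrc : Cycle.Chain (altRel G σ) ((w.rotate y hys).darts : Cycle G.Dart) := by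
      rw [Cycle.coe_eq_coe.2 hrot]; exact hcyc
    have hcnt : ∀ e, (w.rotate y hys).edges.count e = w.edges.count e := fun e =>
      (w.rotate_edges y hys).perm.count_eq e
    have hlen : (w.rotate y hys).length = N := by
      rw [length_le G, ← hN, length_le G]
      simp [hcnt]
    generalize w.rotate y hys = w' at *
    have hch' := chain_of_cycle _ _ hrc
    cases w' with
    | nil => simp at hlen; omega
    | @cons _ a' _ h' p' =>
    have hno : ∀ e : G.edgeSet, y ∈ (e : Sym2 V) →
        0 < (c e : ℤ) - (w.edges.count (e : Sym2 V) : ℤ) →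
        σ e y = σ s(y,a') y := by
      intro e hu he
      by_contra hs
      have hs' : σ e y = - σ s(y,a') y := by
        rcases Int.units_eq_one_or (σ e y) with h | h <;>
        rcases Int.units_eq_one_or (σ s(y,a') y) with h' | h' <;> simp_all
      obtain ⟨y', w', hw, hw2, hw3⟩ := extend_walk G σ c h' p' hch'
        (fun e => by rw [hcnt]; exact hle e) e hu (by rw [hcnt]; omega) hs'
      have := hmax _ ⟨y', _, w', rfl, hw2, hw3⟩
      omega
    have hd := sdeg_const G σ _ y (σ s(y,a') y) (fun e => by have := hle e; omega) hno
    rw [sdeg_sub, hbal, hz] at hd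
    have hnn : (0:ℤ) < ∑ e : G.edgeSet, if y ∈ (e : Sym2 V) then
        (c e : ℤ) - (w.edges.count (e : Sym2 V) : ℤ) else 0 := by
      apply Finset.sum_pos'
      · intro e _
        have := hle e
        split_ifs <;> omega
      · refine ⟨e, Finset.mem_univ _, ?_⟩
        rw [if_pos hy]; omega
    rw [← hd] at hnn
    simp at hnn

lemma mem_support_edge {G : SimpleGraph V} {u v : V} (w : G.Walk u v) (hw : 0 < w.length) (y : V)
    (hy : y ∈ w.support) : ∃ e ∈ w.edges, y ∈ e := by
  induction w with
  | nil => simp at hw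
  | @cons u a v h p ih =>
    rw [SimpleGraph.Walk.support_cons, List.mem_cons] at hy
    rcases hy with rfl | hy
    · exact ⟨s(y,a), by simp, by simp⟩
    · rcases Nat.eq_zero_or_pos p.length with h0 | h0
      · cases p with
        | nil => simp at hy; subst hy; exact ⟨s(u,y), by simp, by simp⟩
        | cons => simp at h0
      · obtain ⟨e, he, hye⟩ := ih h0 hy
        exact ⟨e, by simp [he], hye⟩

lemma exists_decomp [DecidableEq V] (G : SimpleGraph V) [Fintype G.edgeSet]
    (σ : Sym2 V → V → ℤˣ) (N : ℕ) : ∀ (c : G.edgeSet → ℕ), ∑ e, c e ≤ N →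
    (∀ v, sdeg G σ (fun e => (c e : ℤ)) v = 0) →
    ∃ (n : ℕ) (w : Fin n → Σ x : V, G.Walk x x),
      (∀ j, 0 < (w j).2.length) ∧ (∀ j, mu G σ (w j).2 = 1) ∧
      (∀ j, Cycle.Chain (altRel G σ) ((w j).2.darts : Cycle G.Dart)) ∧
      (∀ j j', j ≠ j' → ∀ y, y ∈ (w j).2.support → y ∉ (w j').2.support) ∧
      (∀ e : G.edgeSet, (∑ j, (w j).2.edges.count (e : Sym2 V)) = c e) := by
  induction N with
  | zero =>
    intro c hc _
    refine ⟨0, Fin.elim0, by simp, by simp, by simp, by simp, ?_⟩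
    intro e
    have : c e ≤ ∑ e, c e := Finset.single_le_sum (fun _ _ => Nat.zero_le _) (Finset.mem_univ e)
    simp; omega
  | succ N ih =>
    intro c hc hbal
    by_cases hc0 : ∃ e, 0 < c e
    · obtain ⟨x, w0, hpos, hmu, hcyc, hle, hz, hdis⟩ := exists_component G σ c hc0 hbal
      have hsum : ∑ e : G.edgeSet, (c e - w0.edges.count (e : Sym2 V)) + w0.length
          = ∑ e, c e := by
        rw [length_le G, ← Finset.sum_add_distrib]
        exact Finset.sum_congr rfl fun e _ => Nat.sub_add_cancel (hle e)
      obtain ⟨n, w, k1, k2, k3, k4, k5⟩ := ih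
        (fun e => c e - w0.edges.count (e : Sym2 V)) (by omega) (by
          intro v
          have : (fun e : G.edgeSet => ((c e - w0.edges.count (e : Sym2 V) : ℕ) : ℤ)) =
              fun e => (c e : ℤ) - (w0.edges.count (e : Sym2 V) : ℤ) := by
            funext e
            exact Nat.cast_sub (hle e)
          rw [this, sdeg_sub, hbal, hz, sub_zero])
      have hd : ∀ j y, y ∈ (w j).2.support → y ∉ w0.support := by
        intro j y hy
        obtain ⟨e, he, hye⟩ := mem_support_edge (w j).2 (k1 j) y hy
        have heG := (w j).2.edges_subset_edgeSet he
        have h5 := k5 ⟨e, heG⟩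
        have : (w j).2.edges.count e ≤ ∑ j, (w j).2.edges.count e :=
          Finset.single_le_sum (f := fun j => (w j).2.edges.count e)
            (fun _ _ => Nat.zero_le _) (Finset.mem_univ j)
        have h6 := List.count_pos_iff.2 he
        exact hdis ⟨e, heG⟩ (by
          change w0.edges.count e < _
          change _ = c ⟨e, heG⟩ - w0.edges.count e at h5
          change (∑ j, (w j).2.edges.count e) = _ at h5
          omega) y hye
      refine ⟨n + 1, Fin.cons ⟨x, w0⟩ w, ?_, ?_, ?_, ?_, ?_⟩
      · rw [Fin.forall_fin_succ]; exact ⟨hpos, k1⟩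
      · rw [Fin.forall_fin_succ]; exact ⟨hmu, k2⟩
      · rw [Fin.forall_fin_succ]; exact ⟨hcyc, k3⟩
      · intro j j' hjj y hy hy'
        induction j using Fin.cases with
        | zero =>
          induction j' using Fin.cases with
          | zero => exact hjj rfl
          | succ j' => exact hd j' y hy' hy
        | succ j =>
          induction j' using Fin.cases with
          | zero => exact hd j y hy hy'
          | succ j' => exact k4 j j' (fun h => hjj (by rw [h])) y hy hy'
      · intro e
        rw [Fin.sum_univ_succ]
        change w0.edges.count (e : Sym2 V) + ∑ j, (w j).2.edges.count (e : Sym2 V) = c e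
        rw [k5 e]
        have := hle e
        omega
    · push Not at hc0
      refine ⟨0, Fin.elim0, by simp, by simp, by simp, by simp, ?_⟩
      intro e
      have := hc0 e
      simp; omega

lemma walkSign_twist (G : SimpleGraph V) (τ : Sym2 V → V → ℤˣ) (s : Sym2 V → ℤˣ) {u v : V}
    (w : G.Walk u v) : walkSign G (fun e x => s e * τ e x) w = walkSign G τ w := by
  induction w with
  | nil => rfl
  | cons h p ih =>
    rw [walkSign, walkSign, ih]
    rw [mul_mul_mul_comm, Int.units_mul_self, one_mul]

open MvPolynomial in
/-- For a nonzero integer vector b in the kernel of the incidence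
matrix of a signed graph (G,τ), every connected component D of the multigraph G_b
(with |b_e| parallel copies of each edge e) admits an Eulerian closed walk w_D which
is even in (G,τ) — i.e. there is a family of pairwise vertex-disjoint nontrivial even
closed walks of G using each edge e exactly |b_e| times in total — and the binomial
e^{b⁺} - e^{b⁻} factors as ∏_D B_{w_D}⁺ - ∏_D B_{w_D}⁻. -/
theorem kernel_binomial_factorization [DecidableEq V] (K : Type*) [Field K]
    (G : SimpleGraph V) [Fintype G.edgeSet] (τ : Sym2 V → V → ℤˣ)
    (b : G.edgeSet → ℤ) (hb : b ≠ 0)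
    (hker : ∀ v : V, ∑ e : G.edgeSet,
      (if v ∈ (e : Sym2 V) then (τ e v : ℤ) else 0) * b e = 0) :
    ∃ (n : ℕ) (x : Fin n → V) (w : ∀ j, G.Walk (x j) (x j))
      (κ : ∀ j, Fin (w j).length → ℤˣ),
      (∀ j, 0 < (w j).length) ∧
      (∀ j, mu G τ (w j) = 1) ∧
      (∀ j, FlipRel G τ (w j) (κ j)) ∧
      -- the walks are Eulerian walks of the distinct connected components of G_b:
      (∀ j j', j ≠ j' → ∀ y, y ∈ (w j).support → y ∉ (w j').support) ∧
      (∀ e : G.edgeSet, (∑ j, (w j).edges.count (e : Sym2 V)) = (b e).natAbs) ∧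
      -- each edge term is used positively or negatively according to the sign of b:
      (∀ j (i : Fin (w j).length),
        κ j i = 1 ↔ 0 < b ⟨(dartAt (w j) i).edge, (dartAt (w j) i).edge_mem⟩) ∧
      (∏ e : G.edgeSet, (X e : MvPolynomial G.edgeSet K) ^ (b e).toNat)
          - (∏ e : G.edgeSet, X e ^ (-(b e)).toNat)
        = (∏ j, Bpos K (w j) (κ j)) - ∏ j, Bneg K (w j) (κ j) := by
  classical
  let s : Sym2 V → ℤˣ := fun e => if h : e ∈ G.edgeSet then (if 0 < b ⟨e, h⟩ then 1 else -1) else 1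
  have hs : ∀ e : G.edgeSet, s e = if 0 < b e then 1 else -1 := by
    intro e; simp [s]
  obtain ⟨n, w, k1, k2, k3, k4, k5⟩ := exists_decomp G (fun e x => s e * τ e x) _
    (fun e => (b e).natAbs) le_rfl (by
      intro v
      rw [← hker v]
      unfold sdeg
      apply Finset.sum_congr rfl
      intro e _
      split_ifs
      · simp only [hs]
        split_ifs with h0
        · simp [abs_of_pos h0]
        · simp [abs_of_nonpos (not_lt.1 h0)]
      · simp)
  have hκ : ∀ j (i : Fin (w j).2.length),
      s (dartAt (w j).2 i).edge = if 0 < b ⟨(dartAt (w j).2 i).edge, (dartAt (w j).2 i).edge_mem⟩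
        then 1 else -1 := fun j i => hs ⟨_, (dartAt (w j).2 i).edge_mem⟩
  have hne : (-1 : ℤˣ) ≠ 1 := by decide
  refine ⟨n, fun j => (w j).1, fun j => (w j).2, fun j i => s (dartAt (w j).2 i).edge,
    k1, ?_, ?_, k4, k5, ?_, ?_⟩
  · intro j
    rw [← k2 j, mu, mu, walkSign_twist]
  · intro j i
    have hi : (i : ℕ) < (w j).2.darts.length := by
      rw [SimpleGraph.Walk.length_darts]; exact i.2
    have := cycle_chain_get _ _ (k3 j) i hi
    have e1 : (w j).2.darts[(i:ℕ)] = dartAt (w j).2 i := rfl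
    have e2 : (w j).2.darts[((i:ℕ)+1) % (w j).2.darts.length]'(Nat.mod_lt _ (by omega))
        = dartAt (w j).2 (csucc i) := by
      simp [dartAt, csucc]
    rw [e1, e2] at this
    unfold altRel at this
    beta_reduce at this
    change s (dartAt (w j).2 (csucc i)).edge = -(τ (dartAt (w j).2 i).edge
      (dartAt (w j).2 i).toProd.2 * τ (dartAt (w j).2 (csucc i)).edge
      (dartAt (w j).2 i).toProd.2) * s (dartAt (w j).2 i).edge
    clear_value s
    generalize s (dartAt (w j).2 i).edge = a at *
    generalize s (dartAt (w j).2 (csucc i)).edge = a' at *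
    generalize τ (dartAt (w j).2 i).edge (dartAt (w j).2 i).toProd.2 = t at *
    generalize τ (dartAt (w j).2 (csucc i)).edge (dartAt (w j).2 i).toProd.2 = t' at *
    clear * - this
    revert this
    revert a a' t t'
    decide
  · intro j i
    simp only [hκ]
    split_ifs with h0 <;> simp [h0, hne]
  · have hp : ∀ j, Bpos K (w j).2 (fun i => s (dartAt (w j).2 i).edge) =
        ∏ e : G.edgeSet, (if 0 < b e then (X e : MvPolynomial G.edgeSet K) else 1) ^
          (w j).2.edges.count (e : Sym2 V) := by
      intro j
      rw [← prod_dartAt, Bpos, Finset.prod_filter]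
      apply Finset.prod_congr rfl
      intro i _
      by_cases h0 : 0 < b ⟨(dartAt (w j).2 i).edge, (dartAt (w j).2 i).edge_mem⟩
      · simp only [hκ, if_pos h0, if_true]
      · simp only [hκ, if_neg h0, hne, if_false]
    have hn : ∀ j, Bneg K (w j).2 (fun i => s (dartAt (w j).2 i).edge) =
        ∏ e : G.edgeSet, (if 0 < b e then (1 : MvPolynomial G.edgeSet K) else X e) ^
          (w j).2.edges.count (e : Sym2 V) := by
      intro j
      rw [← prod_dartAt, Bneg, Finset.prod_filter]
      apply Finset.prod_congr rfl
      intro i _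
      by_cases h0 : 0 < b ⟨(dartAt (w j).2 i).edge, (dartAt (w j).2 i).edge_mem⟩
      · simp only [hκ, if_pos h0, hne.symm, if_false]
      · simp only [hκ, if_neg h0, if_true]
    simp only [hp, hn]
    rw [Finset.prod_comm, Finset.prod_comm (s := (Finset.univ : Finset (Fin n)))]
    simp only [Finset.prod_pow_eq_pow_sum, k5]
    congr 1 <;> apply Finset.prod_congr rfl <;> intro e _ <;> split_ifs with h0
    · congr 1; omega
    · rw [one_pow, Int.toNat_of_nonpos (by omega), pow_zero]
    · rw [one_pow, Int.toNat_of_nonpos (by omega), pow_zero]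
    · congr 1; omega
end
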